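/- arXiv:2308.06380 — 2 statements merged into one kernel-verified Lean document; each statement's English description precedes it below -/
import Mathlib

section
/- (Variance bound for repulsive gases) Let V be a pair potential in dimension d with V(x) ≥ 0 for all x and C(β) = ∫_{ℝ^d} (1 − e^{−βV(x)}) dx < ∞ for β > 0. Let Λ ⊂ ℝ^d be measurable with finite positive volume, let λ > 0, and set Z_0 = 1 and Z_N = ∫_{Λ^N} exp(−β ∑_{1≤i<j≤N} V(x_i − x_j)) dx_1⋯dx_N for N ≥ 1. Define Ξ = ∑_{N≥0} λ^N Z_N / N!, ⟨N⟩ = Ξ^{−1} ∑_{N≥0} N λ^N Z_N / N!, and ⟨N²⟩ = Ξ^{−1} ∑_{N≥0} N² λ^N Z_N / N! (all series converge since 0 ≤ Z_N ≤ |Λ|^N). Then ⟨N⟩ ≤ (⟨N²⟩ − ⟨N⟩²)(1 + λ C(β)). -/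
open MeasureTheory
open scoped BigOperators

noncomputable section
open Classical

/-- The total pair interaction energy `∑_{1 ≤ i < j ≤ n} V (x i - x j)`. -/
def pairEnergy {d : ℕ} (V : EuclideanSpace ℝ (Fin d) → ℝ) {n : ℕ}
    (x : Fin n → EuclideanSpace ℝ (Fin d)) : ℝ :=
  ∑ p ∈ Finset.univ.filter (fun p : Fin n × Fin n => p.1 < p.2), V (x p.1 - x p.2)

/-- The configurational integral `Z_N = ∫_{Λ^N} exp(-β ∑_{i<j} V(x_i - x_j)) dx_1 ⋯ dx_N`
(for `N = 0` this equals `1`). -/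
def confIntegral {d : ℕ} (β : ℝ) (V : EuclideanSpace ℝ (Fin d) → ℝ)
    (Λ : Set (EuclideanSpace ℝ (Fin d))) (N : ℕ) : ℝ :=
  ∫ x in Set.univ.pi (fun _ : Fin N => Λ), Real.exp (-(β * pairEnergy V x))

/-- Abstract summation part. -/
lemma abstract_bound (a r : ℕ → ℝ) (K c : ℝ) (ha : ∀ N, 0 < a N) (hr0 : ∀ N, 0 < r N)
    (hrK : ∀ N, r N ≤ K) (hra : ∀ N : ℕ, ((N : ℝ) + 1) * a (N + 1) = r N * a N)
    (hc : 0 ≤ c) (hG : ∀ N, r N ≤ r (N + 1) + c) :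
    (∑' N : ℕ, (N : ℝ) * a N) / (∑' N, a N) ≤
      ((∑' N : ℕ, (N : ℝ) ^ 2 * a N) / (∑' N, a N) - ((∑' N : ℕ, (N : ℝ) * a N) / (∑' N, a N)) ^ 2)
        * (1 + c) := by
  have hK : 0 < K := (hr0 0).trans_le (hrK 0)
  have hb : ∀ N, a N ≤ a 0 * (K ^ N / N.factorial) := by
    intro N
    induction N with
    | zero => simp
    | succ n ih =>
      have h1 : a (n + 1) = r n * a n / ((n : ℝ) + 1) := by
        rw [← hra]; field_simp
      rw [h1, Nat.factorial_succ, pow_succ]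
      push_cast
      have : a 0 * (K ^ n * K / (((n : ℝ) + 1) * n.factorial))
          = K * (a 0 * (K ^ n / n.factorial)) / ((n : ℝ) + 1) := by field_simp
      rw [this]
      have := hrK n
      have := (ha n).le
      gcongr
  have s2 : Summable (fun N : ℕ => (N : ℝ) ^ 2 * a N) := by
    refine Summable.of_nonneg_of_le (fun N => by have := ha N; positivity) ?_
      ((Real.summable_pow_div_factorial (4 * K)).mul_left (a 0))
    intro N
    have h2 : (N : ℝ) ≤ 2 ^ N := by exact_mod_cast (Nat.lt_two_pow_self).le
    have h4 : (N : ℝ) ^ 2 ≤ 4 ^ N := by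
      calc (N : ℝ) ^ 2 ≤ (2 ^ N) ^ 2 := by gcongr
        _ = 4 ^ N := by rw [← pow_mul, mul_comm, pow_mul]; norm_num
    calc (N : ℝ) ^ 2 * a N ≤ 4 ^ N * (a 0 * (K ^ N / N.factorial)) := by
          have := (ha N).le
          have := hb N
          gcongr
      _ = _ := by rw [mul_pow]; ring
  have s0 : Summable a := by
    refine Summable.of_nonneg_of_le (fun N => (ha N).le) hb
      ((Real.summable_pow_div_factorial K).mul_left (a 0))
  have s1 : Summable (fun N : ℕ => (N : ℝ) * a N) := by
    refine Summable.of_nonneg_of_le (fun N => by have := ha N; positivity) ?_ s2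
    intro N
    have := (ha N).le
    gcongr
    exact_mod_cast Nat.le_self_pow two_ne_zero N
  set S0 := ∑' N, a N with hS0
  set S1 := ∑' N : ℕ, (N : ℝ) * a N with hS1
  set S2 := ∑' N : ℕ, (N : ℝ) ^ 2 * a N with hS2
  have h0 := s0.hasSum
  have h1 := s1.hasSum
  have h2 := s2.hasSum
  rw [← hS0] at h0
  rw [← hS1] at h1
  rw [← hS2] at h2
  have e1 : HasSum (fun N => r N * a N) S1 := by
    have := (hasSum_nat_add_iff' 1).2 h1
    simp only [Finset.sum_range_one, Nat.cast_zero, zero_mul, sub_zero] at this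
    refine this.congr_fun ?_ 
    intro N; rw [← hra]; push_cast; ring
  have h21 := h2.sub h1
  have e2 : HasSum (fun N : ℕ => (N : ℝ) * (r N * a N)) (S2 - S1) := by
    have := (hasSum_nat_add_iff' 1).2 h21
    simp at this
    refine this.congr_fun ?_
    intro N; rw [← hra]; push_cast; ring
  have e3 : HasSum (fun N : ℕ => r (N + 1) * (r N * a N)) (S2 - S1) := by
    have := (hasSum_nat_add_iff' 2).2 h21
    simp [Finset.sum_range_succ] at this
    refine this.congr_fun ?_
    intro N
    rw [← hra]
    have := hra (N + 1)
    push_cast at *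
    linear_combination -((N : ℝ) + 1) * this
  have sQ : Summable (fun N => r N * (r N * a N)) := by
    refine Summable.of_nonneg_of_le
      (fun N => by have := ha N; have := hr0 N; positivity) ?_ (e1.summable.mul_left K)
    intro N
    have := hrK N
    have := ha N
    have := hr0 N
    gcongr
  obtain ⟨Q, hQ⟩ := sQ
  have hQle : Q ≤ S2 - S1 + c * S1 := by
    refine hasSum_le ?_ hQ (e3.add (e1.mul_left c))
    intro N
    have := ha N
    have := hr0 N
    have := mul_le_mul_of_nonneg_right (hG N) (show 0 ≤ r N * a N by positivity)
    linarith
  have quad : ∀ s t u : ℝ, 0 ≤ s ^ 2 * Q + t ^ 2 * S2 + u ^ 2 * S0 - 2 * s * t * (S2 - S1)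
      - 2 * s * u * S1 + 2 * t * u * S1 := by
    intro s t u
    have := ((((hQ.mul_left (s ^ 2)).add (h2.mul_left (t ^ 2))).add (h0.mul_left (u ^ 2))).sub
      (e2.mul_left (2 * s * t))).sub (e1.mul_left (2 * s * u)) |>.add (h1.mul_left (2 * t * u))
    refine this.nonneg ?_
    intro N
    have h : 0 ≤ (s * r N - t * N - u) ^ 2 * a N := by have := ha N; positivity
    nlinarith [h]
  have S0pos : 0 < S0 := s0.tsum_pos (fun N => (ha N).le) 0 (ha 0)
  have S1pos : 0 < S1 := s1.tsum_pos (fun N => by have := ha N; positivity) 1 (by simpa using ha 1)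
  -- normalise
  set n := S1 / S0 with hn
  set m := S2 / S0 with hm
  have npos : 0 < n := by positivity
  have hS1n : S1 = n * S0 := by rw [hn]; field_simp
  have hS2m : S2 = m * S0 := by rw [hm]; field_simp
  set v := m - n ^ 2 with hv
  have key : ∀ t : ℝ, 0 ≤ v * (t * t) + (-2 * (v - n)) * t + (v - n + c * n) := by
    intro t
    have h := quad 1 t (n - t * n)
    have : 0 ≤ S0 * (v * (t * t) + (-2 * (v - n)) * t + (v - n + c * n)) := by
      rw [hS1n, hS2m] at h hQle
      rw [hv]
      nlinarith [h, hQle]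
    exact nonneg_of_mul_nonneg_right this S0pos
  have hd := discrim_le_zero key
  rw [discrim] at hd
  have : n * n ≤ n * (v * (1 + c)) := by nlinarith [hd]
  exact le_of_mul_le_mul_left this npos

lemma pairEnergy_cons {d : ℕ} (V : EuclideanSpace ℝ (Fin d) → ℝ) {n : ℕ}
    (y : EuclideanSpace ℝ (Fin d)) (x : Fin n → EuclideanSpace ℝ (Fin d)) :
    pairEnergy V (Fin.cons y x : Fin (n + 1) → EuclideanSpace ℝ (Fin d)) =
      (∑ j, V (y - x j)) + pairEnergy V x := by
  unfold pairEnergy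
  simp only [Finset.sum_filter, Fintype.sum_prod_type]
  rw [Fin.sum_univ_succ]
  congr 1
  · rw [Fin.sum_univ_succ]; simp [Fin.succ_pos]
  · refine Finset.sum_congr rfl fun i _ => ?_
    rw [Fin.sum_univ_succ]; simp

lemma pairEnergy_nonneg {d : ℕ} (V : EuclideanSpace ℝ (Fin d) → ℝ) (hV : ∀ x, 0 ≤ V x) {n : ℕ}
    (x : Fin n → EuclideanSpace ℝ (Fin d)) : 0 ≤ pairEnergy V x :=
  Finset.sum_nonneg fun _ _ => hV _

lemma pairEnergy_meas {d : ℕ} (V : EuclideanSpace ℝ (Fin d) → ℝ) (hV : Measurable V) {n : ℕ} :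
    Measurable (fun x : Fin n → EuclideanSpace ℝ (Fin d) => pairEnergy V x) := by
  unfold pairEnergy
  fun_prop

lemma integral_pi_cons {E : Type*} [MeasurableSpace E] (μ : Measure E) [IsFiniteMeasure μ] {n : ℕ}
    (F : (Fin (n + 1) → E) → ℝ) (hF : Integrable F (Measure.pi fun _ => μ)) :
    ∫ x, F x ∂(Measure.pi fun _ => μ) =
      ∫ x : Fin n → E, ∫ y, F (Fin.cons y x) ∂μ ∂(Measure.pi fun _ => μ) := by
  have mp := (measurePreserving_piFinSuccAbove (fun _ : Fin (n + 1) => μ) 0).symm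
  have he : ∀ p : E × (Fin n → E),
      (MeasurableEquiv.piFinSuccAbove (fun _ : Fin (n + 1) => E) 0).symm p = Fin.cons p.1 p.2 := by
    intro p
    simp [MeasurableEquiv.piFinSuccAbove, Fin.insertNthEquiv]
  rw [← mp.integral_comp' F]
  have hi := (mp.integrable_comp_emb (MeasurableEquiv.measurableEmbedding _)).2 hF
  rw [integral_prod_symm]
  · simp only [he]
  · exact hi

lemma integrable_bdd {E : Type*} [MeasurableSpace E] (μ : Measure E) [IsFiniteMeasure μ]
    (F : E → ℝ) (hF : Measurable F) (M : ℝ) (h0 : ∀ x, 0 ≤ F x) (hM : ∀ x, F x ≤ M) :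
    Integrable F μ :=
  Integrable.of_bound hF.aestronglyMeasurable M
    (Filter.Eventually.of_forall fun x => by rw [Real.norm_of_nonneg (h0 x)]; exact hM x)

lemma confIntegral_eq {d : ℕ} (β : ℝ) (V : EuclideanSpace ℝ (Fin d) → ℝ)
    (Λ : Set (EuclideanSpace ℝ (Fin d))) (N : ℕ) :
    confIntegral β V Λ N = ∫ x : Fin N → EuclideanSpace ℝ (Fin d),
      Real.exp (-(β * pairEnergy V x)) ∂(Measure.pi fun _ => volume.restrict Λ) := by
  unfold confIntegral
  rw [volume_pi, Measure.restrict_pi_pi]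

lemma cons_meas_prod {E : Type*} [MeasurableSpace E] {n : ℕ}
    (F : (Fin (n + 1) → E) → ℝ) (hF : Measurable F) :
    Measurable (fun p : (Fin n → E) × E => F (Fin.cons p.2 p.1)) := by
  have hc : Measurable (fun p : (Fin n → E) × E => (Fin.cons p.2 p.1 : Fin (n + 1) → E)) := by
    refine measurable_pi_iff.2 fun i => ?_
    refine Fin.cases ?_ (fun j => ?_) i
    · simpa using measurable_snd
    · simp only [Fin.cons_succ]; fun_prop
  exact hF.comp hc

lemma cons_meas {E : Type*} [MeasurableSpace E] {n : ℕ}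
    (F : (Fin (n + 1) → E) → ℝ) (hF : Measurable F) (x : Fin n → E) :
    Measurable (fun z : E => F (Fin.cons z x)) :=
  (cons_meas_prod F hF).comp (measurable_prodMk_left (x := x))

section gas

variable {d : ℕ} (β : ℝ)
    (V : EuclideanSpace ℝ (Fin d) → ℝ)
    (Λ : Set (EuclideanSpace ℝ (Fin d)))

/-- Boltzmann weight of a configuration. -/
def wt {n : ℕ} (x : Fin n → EuclideanSpace ℝ (Fin d)) : ℝ := Real.exp (-(β * pairEnergy V x))

/-- Boltzmann weight of an added particle. -/
def ew {n : ℕ} (y : EuclideanSpace ℝ (Fin d)) (x : Fin n → EuclideanSpace ℝ (Fin d)) : ℝ :=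
  Real.exp (-(β * ∑ j, V (y - x j)))

/-- Free volume. -/
def fv {n : ℕ} (x : Fin n → EuclideanSpace ℝ (Fin d)) : ℝ := ∫ y in Λ, ew β V y x

lemma wt_cons {n : ℕ} (y : EuclideanSpace ℝ (Fin d)) (x : Fin n → EuclideanSpace ℝ (Fin d)) :
    wt β V (Fin.cons y x : Fin (n + 1) → EuclideanSpace ℝ (Fin d)) = ew β V y x * wt β V x := by
  unfold wt ew
  rw [pairEnergy_cons, ← Real.exp_add]; congr 1; ring

lemma ew_cons {n : ℕ} (y z : EuclideanSpace ℝ (Fin d)) (x : Fin n → EuclideanSpace ℝ (Fin d)) :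
    ew β V y (Fin.cons z x : Fin (n + 1) → EuclideanSpace ℝ (Fin d)) =
      Real.exp (-(β * V (y - z))) * ew β V y x := by
  unfold ew
  rw [Fin.sum_univ_succ, ← Real.exp_add]; simp; ring

lemma wt_pos {n : ℕ} (x : Fin n → EuclideanSpace ℝ (Fin d)) : 0 < wt β V x := Real.exp_pos _

lemma ew_pos {n : ℕ} (y : EuclideanSpace ℝ (Fin d)) (x : Fin n → EuclideanSpace ℝ (Fin d)) :
    0 < ew β V y x := Real.exp_pos _

lemma wt_le (hβ : 0 < β) (hVpos : ∀ x, 0 ≤ V x) {n : ℕ}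
    (x : Fin n → EuclideanSpace ℝ (Fin d)) : wt β V x ≤ 1 := by
  have := pairEnergy_nonneg V hVpos x
  apply Real.exp_le_one_iff.2
  have : 0 ≤ β * pairEnergy V x := by positivity
  linarith

lemma ew_le (hβ : 0 < β) (hVpos : ∀ x, 0 ≤ V x) {n : ℕ} (y : EuclideanSpace ℝ (Fin d))
    (x : Fin n → EuclideanSpace ℝ (Fin d)) : ew β V y x ≤ 1 := by
  have : 0 ≤ ∑ j, V (y - x j) := Finset.sum_nonneg fun _ _ => hVpos _
  apply Real.exp_le_one_iff.2
  have : 0 ≤ β * ∑ j, V (y - x j) := by positivity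
  linarith

lemma wt_meas (hVmeas : Measurable V) {n : ℕ} :
    Measurable (fun x : Fin n → EuclideanSpace ℝ (Fin d) => wt β V x) := by
  have := pairEnergy_meas V hVmeas (n := n)
  unfold wt
  fun_prop

lemma ew_meas (hVmeas : Measurable V) {n : ℕ} :
    Measurable (fun p : (Fin n → EuclideanSpace ℝ (Fin d)) × EuclideanSpace ℝ (Fin d) =>
      ew β V p.2 p.1) := by
  unfold ew
  fun_prop

lemma fv_meas (hVmeas : Measurable V) {n : ℕ} :
    Measurable (fun x : Fin n → EuclideanSpace ℝ (Fin d) => fv β V Λ x) := by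
  have h := (ew_meas β V hVmeas (n := n)).stronglyMeasurable.integral_prod_right'
    (ν := volume.restrict Λ)
  exact h.measurable

lemma ew_int (hβ : 0 < β) (hVmeas : Measurable V) (hVpos : ∀ x, 0 ≤ V x)
    [IsFiniteMeasure (volume.restrict Λ)] {n : ℕ} (x : Fin n → EuclideanSpace ℝ (Fin d)) :
    Integrable (fun y => ew β V y x) (volume.restrict Λ) := by
  have hm : Measurable (fun y => ew β V y x) := by
    unfold ew
    fun_prop
  exact integrable_bdd _ _ hm 1 (fun y => (ew_pos β V y x).le) (fun y => ew_le β V hβ hVpos y x)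

lemma fv_nonneg {n : ℕ} (x : Fin n → EuclideanSpace ℝ (Fin d)) : 0 ≤ fv β V Λ x :=
  integral_nonneg fun y => (ew_pos β V y x).le

lemma fv_le (hβ : 0 < β) (hVmeas : Measurable V) (hVpos : ∀ x, 0 ≤ V x)
    [IsFiniteMeasure (volume.restrict Λ)] {n : ℕ} (x : Fin n → EuclideanSpace ℝ (Fin d)) :
    fv β V Λ x ≤ (volume.restrict Λ).real Set.univ := by
  have := integral_mono (ew_int β V Λ hβ hVmeas hVpos x) (integrable_const (1 : ℝ))
    (fun y => ew_le β V hβ hVpos y x)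
  simpa [fv] using this

lemma fv_cons (hβ : 0 < β) (hVmeas : Measurable V) (hVpos : ∀ x, 0 ≤ V x)
    (hC : Integrable (fun x : EuclideanSpace ℝ (Fin d) => 1 - Real.exp (-(β * V x))))
    [IsFiniteMeasure (volume.restrict Λ)] {n : ℕ} (z : EuclideanSpace ℝ (Fin d))
    (x : Fin n → EuclideanSpace ℝ (Fin d)) :
    fv β V Λ x - (∫ x : EuclideanSpace ℝ (Fin d), (1 - Real.exp (-(β * V x)))) ≤
      fv β V Λ (Fin.cons z x : Fin (n + 1) → EuclideanSpace ℝ (Fin d)) := by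
  have hnn : ∀ x, 0 ≤ 1 - Real.exp (-(β * V x)) := fun x => by
    have : 0 ≤ β * V x := mul_nonneg hβ.le (hVpos x)
    have : Real.exp (-(β * V x)) ≤ 1 := Real.exp_le_one_iff.2 (by linarith)
    linarith
  have hCz : Integrable (fun y : EuclideanSpace ℝ (Fin d) => 1 - Real.exp (-(β * V (y - z)))) :=
    hC.comp_sub_right z
  have h1 : ∫ y in Λ, (1 - Real.exp (-(β * V (y - z)))) ≤
      ∫ x : EuclideanSpace ℝ (Fin d), (1 - Real.exp (-(β * V x))) := by
    rw [← integral_sub_right_eq_self (fun x => 1 - Real.exp (-(β * V x))) z]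
    exact setIntegral_le_integral hCz (Filter.Eventually.of_forall fun y => hnn _)
  have h2 : fv β V Λ x - ∫ y in Λ, (1 - Real.exp (-(β * V (y - z)))) ≤
      fv β V Λ (Fin.cons z x : Fin (n + 1) → EuclideanSpace ℝ (Fin d)) := by
    unfold fv
    rw [← integral_sub (ew_int β V Λ hβ hVmeas hVpos x) hCz.integrableOn]
    refine integral_mono ((ew_int β V Λ hβ hVmeas hVpos x).sub hCz.integrableOn)
      (ew_int β V Λ hβ hVmeas hVpos _) ?_
    intro y
    simp only [ew_cons]
    nlinarith [hnn (y - z), ew_le β V hβ hVpos y x]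
  linarith

lemma Z_succ (hβ : 0 < β) (hVmeas : Measurable V) (hVpos : ∀ x, 0 ≤ V x)
    [IsFiniteMeasure (volume.restrict Λ)] (n : ℕ) :
    confIntegral β V Λ (n + 1) = ∫ x : Fin n → EuclideanSpace ℝ (Fin d),
      fv β V Λ x * wt β V x ∂(Measure.pi fun _ => volume.restrict Λ) := by
  rw [confIntegral_eq]
  change ∫ x, wt β V x ∂_ = _
  rw [integral_pi_cons _ _ (integrable_bdd _ _ (wt_meas β V hVmeas) 1
    (fun x => (wt_pos β V x).le) (wt_le β V hβ hVpos))]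
  simp only [wt_cons, integral_mul_const]
  rfl

lemma fvwt_int (hβ : 0 < β) (hVmeas : Measurable V) (hVpos : ∀ x, 0 ≤ V x)
    [IsFiniteMeasure (volume.restrict Λ)] (n k : ℕ) :
    Integrable (fun x : Fin n → EuclideanSpace ℝ (Fin d) => fv β V Λ x ^ k * wt β V x)
      (Measure.pi fun _ => volume.restrict Λ) := by
  refine integrable_bdd _ _ (((fv_meas β V Λ hVmeas).pow_const k).mul (wt_meas β V hVmeas))
    (((volume.restrict Λ).real Set.univ) ^ k * 1) ?_ ?_
  · intro x
    have := fv_nonneg β V Λ x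
    have := wt_pos β V x
    positivity
  · intro x
    have := fv_nonneg β V Λ x
    have := (wt_pos β V x).le
    have := fv_le β V Λ hβ hVmeas hVpos x
    have := wt_le β V hβ hVpos x
    gcongr

lemma Z_pos (hβ : 0 < β) (hVmeas : Measurable V) (hVpos : ∀ x, 0 ≤ V x) (hΛpos : 0 < volume Λ)
    [IsFiniteMeasure (volume.restrict Λ)] (n : ℕ) : 0 < confIntegral β V Λ n := by
  rw [confIntegral_eq]
  have hi := fvwt_int β V Λ hβ hVmeas hVpos n 0
  simp only [pow_zero, one_mul] at hi
  refine (integral_pos_iff_support_of_nonneg (fun x => (Real.exp_pos _).le) hi).2 ?_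
  have : (Function.support fun x : Fin n → EuclideanSpace ℝ (Fin d) =>
      Real.exp (-(β * pairEnergy V x))) = Set.univ := by
    ext x; simp [Real.exp_ne_zero]
  rw [this, Measure.pi_univ]
  simp only [Measure.restrict_apply_univ, Finset.prod_const]
  exact pos_iff_ne_zero.2 (pow_ne_zero _ hΛpos.ne')

lemma Z_le (hβ : 0 < β) (hVmeas : Measurable V) (hVpos : ∀ x, 0 ≤ V x)
    [IsFiniteMeasure (volume.restrict Λ)] (n : ℕ) :
    confIntegral β V Λ (n + 1) ≤ (volume.restrict Λ).real Set.univ * confIntegral β V Λ n := by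
  rw [Z_succ β V Λ hβ hVmeas hVpos, confIntegral_eq, ← integral_const_mul]
  have h0 := fvwt_int β V Λ hβ hVmeas hVpos n 0
  have h1 := fvwt_int β V Λ hβ hVmeas hVpos n 1
  simp only [pow_zero, one_mul, pow_one] at h0 h1
  refine integral_mono h1 (h0.const_mul _) ?_
  intro x
  exact mul_le_mul_of_nonneg_right (fv_le β V Λ hβ hVmeas hVpos x) (wt_pos β V x).le

lemma ginibre (hβ : 0 < β) (hVmeas : Measurable V) (hVpos : ∀ x, 0 ≤ V x)
    (hC : Integrable (fun x : EuclideanSpace ℝ (Fin d) => 1 - Real.exp (-(β * V x))))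
    (hΛpos : 0 < volume Λ) [IsFiniteMeasure (volume.restrict Λ)] (n : ℕ) :
    confIntegral β V Λ (n + 1) / confIntegral β V Λ n ≤
      confIntegral β V Λ (n + 2) / confIntegral β V Λ (n + 1) +
        ∫ x : EuclideanSpace ℝ (Fin d), (1 - Real.exp (-(β * V x))) := by
  set C := ∫ x : EuclideanSpace ℝ (Fin d), (1 - Real.exp (-(β * V x))) with hCdef
  have hZ0 := Z_pos β V Λ hβ hVmeas hVpos hΛpos n
  have hZ1 := Z_pos β V Λ hβ hVmeas hVpos hΛpos (n + 1)
  have e0 : confIntegral β V Λ n = ∫ x : Fin n → EuclideanSpace ℝ (Fin d),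
      wt β V x ∂(Measure.pi fun _ => volume.restrict Λ) := confIntegral_eq β V Λ n
  have e1 := Z_succ β V Λ hβ hVmeas hVpos n
  have e2 := Z_succ β V Λ hβ hVmeas hVpos (n + 1)
  have hI := fvwt_int β V Λ hβ hVmeas hVpos (n + 1) 1
  have i0 := fvwt_int β V Λ hβ hVmeas hVpos n 0
  have i1 := fvwt_int β V Λ hβ hVmeas hVpos n 1
  have i2 := fvwt_int β V Λ hβ hVmeas hVpos n 2
  simp only [pow_zero, one_mul, pow_one] at hI i0 i1
  rw [integral_pi_cons _ _ hI] at e2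
  set t := confIntegral β V Λ (n + 1) / confIntegral β V Λ n with ht
  set μ := volume.restrict Λ with hμ
  -- measurability of the inner function
  have hmI := cons_meas_prod _ ((fv_meas β V Λ hVmeas (n := n + 1)).mul (wt_meas β V hVmeas (n := n + 1)))
  have hmS := cons_meas _ ((fv_meas β V Λ hVmeas (n := n + 1)).mul (wt_meas β V hVmeas (n := n + 1)))
  have hb0 : ∀ X : Fin (n + 1) → EuclideanSpace ℝ (Fin d), 0 ≤ fv β V Λ X * wt β V X := fun X =>
    mul_nonneg (fv_nonneg β V Λ X) (wt_pos β V X).le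
  have hb1 : ∀ X : Fin (n + 1) → EuclideanSpace ℝ (Fin d),
      fv β V Λ X * wt β V X ≤ μ.real Set.univ * 1 := fun X => by
    have := fv_nonneg β V Λ X
    have := (wt_pos β V X).le
    have := fv_le β V Λ hβ hVmeas hVpos X
    have := wt_le β V hβ hVpos X
    gcongr
  have hprod := integrable_bdd ((Measure.pi fun _ : Fin n => μ).prod μ) _ hmI _
    (fun p => hb0 _) (fun p => hb1 _)
  have lower : ∀ x : Fin n → EuclideanSpace ℝ (Fin d),
      (fv β V Λ x - C) * (fv β V Λ x * wt β V x) ≤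
      ∫ z, fv β V Λ (Fin.cons z x : Fin (n + 1) → EuclideanSpace ℝ (Fin d)) *
        wt β V (Fin.cons z x : Fin (n + 1) → EuclideanSpace ℝ (Fin d)) ∂μ := by
    intro x
    have hew := ew_int β V Λ hβ hVmeas hVpos x
    have : (fv β V Λ x - C) * (fv β V Λ x * wt β V x) =
        ∫ z, (fv β V Λ x - C) * (ew β V z x * wt β V x) ∂μ := by
      rw [integral_const_mul, integral_mul_const]; rfl
    rw [this]
    refine integral_mono ((hew.mul_const _).const_mul _) ?_ ?_
    · exact integrable_bdd _ _ (hmS x) _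
        (fun z => hb0 _) (fun z => hb1 _)
    · intro z
      simp only [wt_cons]
      exact mul_le_mul_of_nonneg_right (fv_cons β V Λ hβ hVmeas hVpos hC z x)
        (mul_nonneg (ew_pos β V z x).le (wt_pos β V x).le)
  have big : (2 * t - C) * confIntegral β V Λ (n + 1) - t ^ 2 * confIntegral β V Λ n ≤
      confIntegral β V Λ (n + 2) := by
    rw [e2, e1, e0, ← integral_const_mul, ← integral_const_mul, ← integral_sub (i1.const_mul _)
      (i0.const_mul _)]
    refine integral_mono ((i1.const_mul _).sub (i0.const_mul _)) hprod.integral_prod_left ?_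
    intro x
    refine le_trans ?_ (lower x)
    have : 0 ≤ (fv β V Λ x - t) ^ 2 * wt β V x := mul_nonneg (sq_nonneg _) (wt_pos β V x).le
    change (2 * t - C) * (fv β V Λ x * wt β V x) - t ^ 2 * wt β V x ≤ _
    nlinarith [this]
  have ht1 : confIntegral β V Λ (n + 1) = t * confIntegral β V Λ n := by
    rw [ht]; field_simp
  have : t * confIntegral β V Λ (n + 1) ≤
      confIntegral β V Λ (n + 2) + C * confIntegral β V Λ (n + 1) := by
    have : t ^ 2 * confIntegral β V Λ n = t * confIntegral β V Λ (n + 1) := by rw [ht1]; ring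
    linarith
  have h3 : t - C ≤ confIntegral β V Λ (n + 2) / confIntegral β V Λ (n + 1) := by
    rw [le_div_iff₀ hZ1]; linarith
  linarith

end gas

/-- Variance bound for repulsive gases: with `Ξ` the grand canonical partition function,
`⟨N⟩`, `⟨N²⟩` the first two moments of the particle number and
`C(β) = ∫ (1 - e^{-βV(x)}) dx < ∞`, one has `⟨N⟩ ≤ (⟨N²⟩ - ⟨N⟩²)(1 + λ C(β))`. -/
theorem statement18 {d : ℕ} (β : ℝ) (hβ : 0 < β)
    (V : EuclideanSpace ℝ (Fin d) → ℝ) (hVmeas : Measurable V)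
    (hVsymm : ∀ x, V (-x) = V x) (hVpos : ∀ x, 0 ≤ V x)
    (hC : Integrable (fun x : EuclideanSpace ℝ (Fin d) => 1 - Real.exp (-(β * V x))))
    (Λ : Set (EuclideanSpace ℝ (Fin d))) (hΛmeas : MeasurableSet Λ)
    (hΛpos : 0 < volume Λ) (hΛvol : volume Λ < ⊤)
    (lam : ℝ) (hlam : 0 < lam)
    (Xi avgN avgN2 : ℝ)
    (hXi : Xi = ∑' N : ℕ, lam ^ N * confIntegral β V Λ N / N.factorial)
    (havgN : avgN =
      (∑' N : ℕ, (N : ℝ) * lam ^ N * confIntegral β V Λ N / N.factorial) / Xi)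
    (havgN2 : avgN2 =
      (∑' N : ℕ, (N : ℝ) ^ 2 * lam ^ N * confIntegral β V Λ N / N.factorial) / Xi) :
    avgN ≤ (avgN2 - avgN ^ 2) *
      (1 + lam * ∫ x : EuclideanSpace ℝ (Fin d), (1 - Real.exp (-(β * V x)))) := by
  have : IsFiniteMeasure (volume.restrict Λ) := ⟨by simpa using hΛvol⟩
  have hZ := Z_pos β V Λ hβ hVmeas hVpos hΛpos
  set C := ∫ x : EuclideanSpace ℝ (Fin d), (1 - Real.exp (-(β * V x))) with hCdef
  have hCnn : 0 ≤ C := by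
    refine integral_nonneg fun x => ?_
    have h1 : 0 ≤ β * V x := mul_nonneg hβ.le (hVpos x)
    have h2 : Real.exp (-(β * V x)) ≤ 1 := Real.exp_le_one_iff.2 (by linarith)
    simp only [Pi.zero_apply]
    linarith
  have key := abstract_bound (fun N => lam ^ N * confIntegral β V Λ N / N.factorial)
    (fun N => lam * (confIntegral β V Λ (N + 1) / confIntegral β V Λ N))
    (lam * (volume.restrict Λ).real Set.univ) (lam * C)
    (fun N => by have := hZ N; positivity)
    (fun N => by have := hZ N; have := hZ (N + 1); positivity)
    (fun N => by
      have h := Z_le β V Λ hβ hVmeas hVpos N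
      refine mul_le_mul_of_nonneg_left ?_ hlam.le
      rwa [div_le_iff₀ (hZ N)])
    (fun N => by
      have := (hZ N).ne'
      have h : ((N + 1).factorial : ℝ) = ((N : ℝ) + 1) * N.factorial := by
        rw [Nat.factorial_succ]; push_cast; ring
      simp only [h]
      field_simp
      ring)
    (by positivity)
    (fun N => by
      have h := ginibre β V Λ hβ hVmeas hVpos hC hΛpos N
      rw [← hCdef] at h
      have := mul_le_mul_of_nonneg_left h hlam.le
      linarith)
  simp only [← mul_div_assoc, ← mul_assoc] at key
  rw [← hXi] at key
  simp only [mul_div_assoc] at key havgN havgN2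
  rw [← havgN, ← havgN2] at key
  exact key

end
end

section
/- (Fernández–Procacci convergence criterion) Let (ℙ, ≁) be an abstract polymer system and let ρ, μ : ℙ → [0, ∞) with μ_γ > 0 for all γ ∈ ℙ. For γ ∈ ℙ define Ξ_γ(μ) = 1 + ∑_{n≥1} (1/n!) ∑_{(γ_1, …, γ_n) ∈ ℙ^n : γ_i ≁ γ for all i, and γ_i ∼ γ_j for all i ≠ j} μ_{γ_1}⋯μ_{γ_n} ∈ [0, ∞]. Assume that Ξ_γ(μ) < ∞ and ρ_γ · Ξ_γ(μ) ≤ μ_γ for every γ ∈ ℙ. Then for every γ_0 ∈ ℙ the series |Π|_{γ_0}(ρ) = ∑_{n≥0} (1/n!) ∑_{(γ_1, …, γ_n) ∈ ℙ^n} |φ^T(γ_0, γ_1, …, γ_n)| ρ_{γ_1}⋯ρ_{γ_n} is finite and satisfies |Π|_{γ_0}(ρ) ≤ Ξ_{γ_0}(μ); in particular ρ_{γ_0} |Π|_{γ_0}(ρ) ≤ μ_{γ_0}. -/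
open scoped BigOperators ENNReal

noncomputable section
open Classical

/-- The edges of a simple graph on a linearly ordered vertex type, listed as ordered pairs
`(i, j)` with `i < j` (each unordered edge `{i,j}` appears exactly once). -/
def edgePairs {n : ℕ} (g : SimpleGraph (Fin n)) : Finset (Fin n × Fin n) :=
  Finset.univ.filter fun p => p.1 < p.2 ∧ g.Adj p.1 p.2

/-- The Ursell function of the abstract polymer system with incompatibility relation `R`:
`φ^T(γ_0, …, γ_{n-1}) = ∑ (-1)^{|E_g|}`, summed over connected simple graphs on
`{0, …, n-1}` all of whose edges join incompatible pairs. -/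
def polymerUrsell {P : Type*} (R : P → P → Prop) {n : ℕ} (γ : Fin n → P) : ℤ :=
  ∑ g ∈ (Finset.univ : Finset (SimpleGraph (Fin n))).filter
      (fun g => g.Connected ∧ ∀ p ∈ edgePairs g, R (γ p.1) (γ p.2)),
    (-1 : ℤ) ^ (edgePairs g).card

/-- `Ξ_γ(μ) = 1 + ∑_{n≥1} (1/n!) ∑_{(γ_1,…,γ_n) : γ_i ≁ γ, γ_i ∼ γ_j (i≠j)} μ_{γ_1}⋯μ_{γ_n}`,
as an element of `[0,∞]`. Here `R` is the incompatibility relation `≁`. -/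
def XiHat {P : Type*} (R : P → P → Prop) (μ : P → ℝ) (γ : P) : ℝ≥0∞ :=
  1 + ∑' m : ℕ, (((m + 1).factorial : ℝ≥0∞))⁻¹ *
      ∑' γs : Fin (m + 1) → P,
        (if (∀ i, R (γs i) γ) ∧ (∀ i j, i ≠ j → ¬ R (γs i) (γs j))
          then ∏ i, ENNReal.ofReal (μ (γs i)) else 0)

/-- `|Π|_{γ_0}(ρ) = ∑_{n≥0} (1/n!) ∑_{(γ_1,…,γ_n) ∈ ℙ^n} |φ^T(γ_0,γ_1,…,γ_n)| ρ_{γ_1}⋯ρ_{γ_n}`,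
as an element of `[0,∞]`. -/
def PiAbs {P : Type*} (R : P → P → Prop) (ρ : P → ℝ) (γ0 : P) : ℝ≥0∞ :=
  ∑' m : ℕ, ((m.factorial : ℝ≥0∞))⁻¹ *
      ∑' γs : Fin m → P,
        ((polymerUrsell R (Fin.cons γ0 γs)).natAbs : ℝ≥0∞) *
          ∏ i, ENNReal.ofReal (ρ (γs i))

namespace FP

def Indep {P ι : Type*} (R : P → P → Prop) (γ : ι → P) (V : Finset ι) : Prop :=
  ∀ i ∈ V, ∀ j ∈ V, i ≠ j → ¬ R (γ i) (γ j)

/-- layer recursion with fuel -/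
def fR {P ι : Type*} (R : P → P → Prop) (γ : ι → P) : ℕ → (P → Prop) → Finset ι → ℤ
  | 0, _, V => if V = ∅ then 1 else 0
  | n + 1, N, V => if V = ∅ then 1 else
      ∑ L ∈ V.powerset.filter (fun L => L.Nonempty ∧ (∀ i ∈ L, N (γ i)) ∧ Indep R γ L),
        (-1 : ℤ) ^ L.card * fR R γ n (fun p => ∃ j ∈ L, R p (γ j)) (V \ L)

lemma fR_empty {P ι : Type*} (R : P → P → Prop) (γ : ι → P) (n : ℕ) (N : P → Prop) :
    fR R γ n N ∅ = 1 := by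
  cases n <;> simp [fR]

lemma fR_congr {P ι : Type*} (R : P → P → Prop) (γ γ' : ι → P) (n : ℕ) :
    ∀ (N : P → Prop) (V : Finset ι), (∀ i ∈ V, γ i = γ' i) → fR R γ n N V = fR R γ' n N V := by
  induction n with
  | zero => intro N V h; simp [fR]
  | succ n ih =>
    intro N V h
    simp only [fR]
    split_ifs with hV
    · rfl
    · apply Finset.sum_congr
      · apply Finset.filter_congr
        intro L hL
        rw [Finset.mem_powerset] at hL
        have h1 : (∀ i ∈ L, N (γ i)) ↔ (∀ i ∈ L, N (γ' i)) :=
          forall₂_congr fun i hi => by rw [h i (hL hi)]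
        have h2 : Indep R γ L ↔ Indep R γ' L := by
          unfold Indep
          exact forall₂_congr fun i hi => forall₂_congr fun j hj => by
            rw [h i (hL hi), h j (hL hj)]
        rw [h1, h2]
      · intro L hL
        have hL' : L ⊆ V := Finset.mem_powerset.1 (Finset.mem_filter.1 hL).1
        have : (fun p => ∃ j ∈ L, R p (γ j)) = (fun p => ∃ j ∈ L, R p (γ' j)) := by
          funext p
          apply propext
          exact exists_congr fun j => and_congr_right fun hj => by rw [h j (hL' hj)]
        rw [this, ih _ _ (fun i hi => h i (Finset.mem_sdiff.1 hi).1)]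

lemma ite_iff_congr {a b : Prop} {ha : Decidable a} {hb : Decidable b} (h : a ↔ b) :
    (@ite ℤ a ha 1 0) = @ite ℤ b hb 1 0 := by
  by_cases hb' : b
  · rw [if_pos hb', if_pos (h.2 hb')]
  · rw [if_neg hb', if_neg (fun x => hb' (h.1 x))]

/-- key identity -/
lemma fR_key {P ι : Type*} (R : P → P → Prop) (hR : Symmetric R) (γ : ι → P) (n : ℕ) :
    ∀ (N : P → Prop) (V : Finset ι), V.card ≤ n →
      ∑ S ∈ V.powerset, fR R γ n N S * (if Indep R γ (V \ S) then 1 else 0)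
        = if Indep R γ V ∧ ∀ i ∈ V, ¬ N (γ i) then 1 else 0 := by
  induction n with
  | zero =>
    intro N V h
    have : V = ∅ := by simpa using h
    subst this
    simp [fR]
  | succ n ih =>
    intro N V h
    have e1 : ∀ S ∈ V.powerset, fR R γ (n+1) N S * (if Indep R γ (V \ S) then 1 else 0)
        = (if S = ∅ then (if Indep R γ V then (1:ℤ) else 0) else 0) +
         ∑ L ∈ S.powerset, if (L.Nonempty ∧ (∀ i ∈ L, N (γ i)) ∧ Indep R γ L) then
          (-1 : ℤ) ^ L.card * (fR R γ n (fun p => ∃ j ∈ L, R p (γ j)) (S \ L) *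
            (if Indep R γ (V \ S) then 1 else 0)) else 0 := by
      intro S hS
      by_cases hS0 : S = ∅
      · subst hS0
        simp [fR]
      · simp only [fR, if_neg hS0, zero_add]
        rw [Finset.sum_filter, Finset.sum_mul]
        apply Finset.sum_congr rfl
        intro L hL
        rw [ite_mul, zero_mul, mul_assoc]
    rw [Finset.sum_congr rfl e1, Finset.sum_add_distrib]
    rw [Finset.sum_ite_eq' V.powerset ∅, if_pos (Finset.empty_mem_powerset V)]
    have e2 : ∑ S ∈ V.powerset, ∑ L ∈ S.powerset,
        (if (L.Nonempty ∧ (∀ i ∈ L, N (γ i)) ∧ Indep R γ L) then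
          (-1 : ℤ) ^ L.card * (fR R γ n (fun p => ∃ j ∈ L, R p (γ j)) (S \ L) *
            (if Indep R γ (V \ S) then 1 else 0)) else 0)
        = ∑ L ∈ V.powerset, ∑ T ∈ (V \ L).powerset,
        (if (L.Nonempty ∧ (∀ i ∈ L, N (γ i)) ∧ Indep R γ L) then
          (-1 : ℤ) ^ L.card * (fR R γ n (fun p => ∃ j ∈ L, R p (γ j)) T *
            (if Indep R γ ((V \ L) \ T) then 1 else 0)) else 0) := by
      rw [Finset.sum_sigma', Finset.sum_sigma']
      refine Finset.sum_nbij' (fun x => ⟨x.2, x.1 \ x.2⟩) (fun x => ⟨x.1 ∪ x.2, x.1⟩) ?_ ?_ ?_ ?_ ?_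
      · rintro ⟨S, L⟩ hx
        simp only [Finset.mem_sigma, Finset.mem_powerset] at hx ⊢
        exact ⟨hx.2.trans hx.1, Finset.sdiff_subset_sdiff hx.1 le_rfl⟩
      · rintro ⟨L, T⟩ hx
        simp only [Finset.mem_sigma, Finset.mem_powerset] at hx ⊢
        exact ⟨Finset.union_subset hx.1 (hx.2.trans Finset.sdiff_subset), Finset.subset_union_left⟩
      · rintro ⟨S, L⟩ hx
        simp only [Finset.mem_sigma, Finset.mem_powerset] at hx
        simp [Finset.union_sdiff_of_subset hx.2]
      · rintro ⟨L, T⟩ hx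
        simp only [Finset.mem_sigma, Finset.mem_powerset] at hx
        have : Disjoint T L := Finset.disjoint_of_subset_left hx.2 Finset.sdiff_disjoint
        simp only [Sigma.mk.injEq, heq_eq_eq, true_and]
        rw [Finset.union_sdiff_left, Finset.sdiff_eq_self_of_disjoint this]
      · rintro ⟨S, L⟩ hx
        simp only [Finset.mem_sigma, Finset.mem_powerset] at hx
        have : (V \ L) \ (S \ L) = V \ S := by
          ext i
          simp only [Finset.mem_sdiff]
          have := @hx.2 i
          tauto
        simp only [this]
    rw [e2]
    have e3 : ∀ L ∈ V.powerset, ∑ T ∈ (V \ L).powerset,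
        (if (L.Nonempty ∧ (∀ i ∈ L, N (γ i)) ∧ Indep R γ L) then
          (-1 : ℤ) ^ L.card * (fR R γ n (fun p => ∃ j ∈ L, R p (γ j)) T *
            (if Indep R γ ((V \ L) \ T) then 1 else 0)) else 0)
        = if L = ∅ then 0 else if (∀ i ∈ L, N (γ i)) then (-1 : ℤ) ^ L.card *
           (if Indep R γ V then 1 else 0) else 0 := by
      intro L hL
      rw [Finset.mem_powerset] at hL
      by_cases hL0 : L = ∅
      · simp [hL0]
      rw [if_neg hL0]
      have hne := Finset.nonempty_iff_ne_empty.2 hL0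
      by_cases hN : (∀ i ∈ L, N (γ i))
      swap
      · simp [hN]
      rw [if_pos hN]
      by_cases hI : Indep R γ L
      swap
      · have : ¬ Indep R γ V := fun hV => hI fun i hi j hj => hV i (hL hi) j (hL hj)
        simp [hI, this]
      · rw [Finset.sum_congr rfl (fun T _ => if_pos ⟨hne, hN, hI⟩), ← Finset.mul_sum]
        refine congrArg _ ((ih _ _ ?_).trans ?_)
        rotate_left
        · refine ite_iff_congr ?_
          constructor
          · rintro ⟨h1, h2⟩ i hi j hj hij
            by_cases hiL : i ∈ L <;> by_cases hjL : j ∈ L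
            · exact hI i hiL j hjL hij
            · exact fun hr => h2 j (Finset.mem_sdiff.2 ⟨hj, hjL⟩) ⟨i, hiL, hR hr⟩
            · exact fun hr => h2 i (Finset.mem_sdiff.2 ⟨hi, hiL⟩) ⟨j, hjL, hr⟩
            · exact h1 i (Finset.mem_sdiff.2 ⟨hi, hiL⟩) j (Finset.mem_sdiff.2 ⟨hj, hjL⟩) hij
          · intro h1
            refine ⟨fun i hi j hj => h1 i (Finset.mem_sdiff.1 hi).1 j (Finset.mem_sdiff.1 hj).1, ?_⟩
            rintro i hi ⟨j, hj, hr⟩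
            rw [Finset.mem_sdiff] at hi
            exact h1 i hi.1 j (hL hj) (by rintro rfl; exact hi.2 hj) hr
        · have h1 := Finset.card_sdiff_add_card_eq_card hL
          have h2 := hne.card_pos
          omega
    rw [Finset.sum_congr rfl e3]
    have e4 : ∑ L ∈ V.powerset, (if L = ∅ then 0 else if (∀ i ∈ L, N (γ i)) then (-1 : ℤ) ^ L.card *
           (if Indep R γ V then 1 else 0) else 0)
        = ∑ L ∈ V.powerset, ((if (∀ i ∈ L, N (γ i)) then (-1 : ℤ) ^ L.card *
           (if Indep R γ V then 1 else 0) else 0) - if L = ∅ then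
            (if Indep R γ V then 1 else 0) else 0) := by
      apply Finset.sum_congr rfl
      intro L hL
      by_cases hL0 : L = ∅
      · simp [hL0]
      · simp [hL0]
    rw [e4, Finset.sum_sub_distrib, Finset.sum_ite_eq' V.powerset ∅,
      if_pos (Finset.empty_mem_powerset V), ← Finset.sum_filter, ← Finset.sum_mul]
    have e5 : V.powerset.filter (fun L => ∀ i ∈ L, N (γ i))
        = (V.filter (fun i => N (γ i))).powerset := by
      ext L
      simp only [Finset.mem_filter, Finset.mem_powerset, Finset.subset_iff]
      exact ⟨fun h i hi => ⟨h.1 hi, h.2 i hi⟩, fun h => ⟨fun i hi => (h hi).1, fun i hi => (h hi).2⟩⟩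
    rw [e5, Finset.sum_powerset_neg_one_pow_card]
    have e6 : V.filter (fun i => N (γ i)) = ∅ ↔ ∀ i ∈ V, ¬ N (γ i) := Finset.filter_eq_empty_iff
    by_cases hI : Indep R γ V <;> by_cases hN : ∀ i ∈ V, ¬ N (γ i)
    · rw [if_pos (e6.2 hN), if_pos hI, if_pos ⟨hI, hN⟩]; ring
    · rw [if_neg (fun h => hN (e6.1 h)), if_neg (c := Indep R γ V ∧ _) (fun h => hN h.2)]; ring
    · simp [hI]
    · simp [hI]

end FP

namespace FP

variable {P : Type*} {n : ℕ}

/-- admissible edges inside `U` -/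
def EG (R : P → P → Prop) (γ : Fin n → P) (U : Finset (Fin n)) : Finset (Fin n × Fin n) :=
  Finset.univ.filter fun p => p.1 < p.2 ∧ R (γ p.1) (γ p.2) ∧ p.1 ∈ U ∧ p.2 ∈ U

def Stp (E : Finset (Fin n × Fin n)) (x y : Fin n) : Prop := (x, y) ∈ E ∨ (y, x) ∈ E

def Rch (E : Finset (Fin n × Fin n)) (x y : Fin n) : Prop := Relation.ReflTransGen (Stp E) x y

def Phi (R : P → P → Prop) (γ : Fin n → P) (z : Fin n) (U : Finset (Fin n)) : ℤ :=
  ∑ E ∈ (EG R γ U).powerset.filter (fun E => ∀ v ∈ U, Rch E z v), (-1 : ℤ) ^ E.card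

lemma EG_mono (R : P → P → Prop) (γ : Fin n → P) {U W : Finset (Fin n)} (h : U ⊆ W) :
    EG R γ U ⊆ EG R γ W := by
  intro p hp
  simp only [EG, Finset.mem_filter, Finset.mem_univ, true_and] at hp ⊢
  exact ⟨hp.1, hp.2.1, h hp.2.2.1, h hp.2.2.2⟩

lemma sum_EG (R : P → P → Prop) (hR : Symmetric R) (γ : Fin n → P) (U : Finset (Fin n)) :
    ∑ E ∈ (EG R γ U).powerset, (-1 : ℤ) ^ E.card = if Indep R γ U then 1 else 0 := by
  rw [Finset.sum_powerset_neg_one_pow_card]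
  apply ite_iff_congr
  rw [EG, Finset.filter_eq_empty_iff]
  constructor
  · intro h i hi j hj hij hr
    rcases lt_or_gt_of_ne hij with h1 | h1
    · exact h (Finset.mem_univ (i, j)) ⟨h1, hr, hi, hj⟩
    · exact h (Finset.mem_univ (j, i)) ⟨h1, hR hr, hj, hi⟩
  · rintro h ⟨i, j⟩ - ⟨h1, h2, h3, h4⟩
    exact h i h3 j h4 h1.ne h2

lemma fiber (R : P → P → Prop) (γ : Fin n → P) (z : Fin n)
    (V S : Finset (Fin n)) (hz : z ∉ V) (hS : S ⊆ V) :
    ∑ E ∈ (EG R γ (insert z V)).powerset with V.filter (fun v => Rch E z v) = S, (-1 : ℤ) ^ E.card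
      = Phi R γ z (insert z S) * ∑ E ∈ (EG R γ (V \ S)).powerset, (-1 : ℤ) ^ E.card := by
  rw [Phi, Finset.sum_mul_sum, ← Finset.sum_product']
  have hzS : z ∉ S := fun h => hz (hS h)
  refine Finset.sum_nbij' (fun E => (E.filter (fun p => p.1 ∈ insert z S ∧ p.2 ∈ insert z S),
    E.filter (fun p => ¬ (p.1 ∈ insert z S ∧ p.2 ∈ insert z S)))) (fun x => x.1 ∪ x.2) ?_ ?_ ?_ ?_ ?_
  · intro E hE
    simp only [Finset.mem_filter, Finset.mem_powerset] at hE
    obtain ⟨hE, hcomp⟩ := hE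
    have hmem : ∀ v ∈ insert z V, (v ∈ insert z S ↔ Rch E z v) := by
      intro v hv
      rw [Finset.mem_insert] at hv
      rcases hv with rfl | hv
      · simp [Rch, Relation.ReflTransGen.refl]
      · have : v ≠ z := by rintro rfl; exact hz hv
        rw [Finset.mem_insert, ← hcomp, Finset.mem_filter]
        tauto
    have hEe : ∀ p ∈ E, p.1 < p.2 ∧ R (γ p.1) (γ p.2) ∧ p.1 ∈ insert z V ∧ p.2 ∈ insert z V := by
      intro p hp
      simpa [EG] using hE hp
    have hcl : ∀ p ∈ E, (p.1 ∈ insert z S ↔ p.2 ∈ insert z S) := by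
      intro p hp
      rw [hmem _ (hEe p hp).2.2.1, hmem _ (hEe p hp).2.2.2]
      exact ⟨fun h => h.tail (Or.inl hp), fun h => h.tail (Or.inr hp)⟩
    simp only [Finset.mem_product, Finset.mem_filter, Finset.mem_powerset]
    refine ⟨⟨?_, ?_⟩, ?_⟩
    · intro p hp
      rw [Finset.mem_filter] at hp
      simp only [EG, Finset.mem_filter, Finset.mem_univ, true_and]
      exact ⟨(hEe p hp.1).1, (hEe p hp.1).2.1, hp.2⟩
    · intro v hv
      have hr : Rch E z v := (hmem v (Finset.insert_subset_insert _ hS hv)).1 hv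
      clear hv
      induction hr with
      | refl => exact Relation.ReflTransGen.refl
      | tail h1 h2 ih =>
        rename_i b c
        refine Relation.ReflTransGen.tail ih ?_
        rcases h2 with h2 | h2
        · have hb := (hmem _ (hEe _ h2).2.2.1).2 h1
          exact Or.inl (Finset.mem_filter.2 ⟨h2, hb, (hcl _ h2).1 hb⟩)
        · have hb := (hmem _ (hEe _ h2).2.2.2).2 h1
          exact Or.inr (Finset.mem_filter.2 ⟨h2, (hcl _ h2).2 hb, hb⟩)
    · intro p hp
      rw [Finset.mem_filter] at hp
      have h1 := hEe p hp.1
      have h2 := hcl p hp.1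
      have h3 : p.1 ∉ insert z S := fun h => hp.2 ⟨h, h2.1 h⟩
      have h4 : p.2 ∉ insert z S := fun h => hp.2 ⟨h2.2 h, h⟩
      simp only [EG, Finset.mem_filter, Finset.mem_univ, true_and, Finset.mem_sdiff]
      simp only [Finset.mem_insert, not_or] at h1 h3 h4
      tauto
  · rintro ⟨E1, E2⟩ hx
    simp only [Finset.mem_product, Finset.mem_filter, Finset.mem_powerset] at hx ⊢
    obtain ⟨⟨h1, h2⟩, h3⟩ := hx
    refine ⟨Finset.union_subset (h1.trans (EG_mono _ _ (Finset.insert_subset_insert _ hS)))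
      (h3.trans (EG_mono _ _ (Finset.sdiff_subset.trans (Finset.subset_insert _ _)))), ?_⟩
    have hin : ∀ v, Rch (E1 ∪ E2) z v → v ∈ insert z S := by
      intro v hv
      induction hv with
      | refl => exact Finset.mem_insert_self _ _
      | tail h4 h5 ih =>
        rename_i b c
        have hb : b ∉ V \ S := by
          intro hb
          rw [Finset.mem_sdiff] at hb
          rcases Finset.mem_insert.1 ih with rfl | h
          · exact hz hb.1
          · exact hb.2 h
        simp only [Stp, Finset.mem_union] at h5
        rcases h5 with (h5 | h5) | (h5 | h5)
        · have := h1 h5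
          simp only [EG, Finset.mem_filter] at this
          exact this.2.2.2.2
        · have := h3 h5
          simp only [EG, Finset.mem_filter] at this
          exact absurd this.2.2.2.1 hb
        · have := h1 h5
          simp only [EG, Finset.mem_filter] at this
          exact this.2.2.2.1
        · have := h3 h5
          simp only [EG, Finset.mem_filter] at this
          exact absurd this.2.2.2.2 hb
    ext v
    rw [Finset.mem_filter]
    constructor
    · rintro ⟨hv, hr⟩
      rcases Finset.mem_insert.1 (hin v hr) with rfl | h
      · exact absurd hv hz
      · exact h
    · intro hv
      refine ⟨hS hv, ?_⟩
      refine Relation.ReflTransGen.mono (r := Stp E1) ?_ _ _ (h2 v (Finset.mem_insert_of_mem hv))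
      rintro a b (h | h)
      · exact Or.inl (Finset.mem_union_left _ h)
      · exact Or.inr (Finset.mem_union_left _ h)
  · intro E hE
    exact Finset.filter_union_filter_not_eq _ _
  · rintro ⟨E1, E2⟩ hx
    simp only [Finset.mem_product, Finset.mem_filter, Finset.mem_powerset] at hx ⊢
    obtain ⟨⟨h1, h2⟩, h3⟩ := hx
    have a1 : ∀ p ∈ E1, p.1 ∈ insert z S ∧ p.2 ∈ insert z S := by
      intro p hp
      have := h1 hp
      simp only [EG, Finset.mem_filter] at this
      exact this.2.2.2
    have a2 : ∀ p ∈ E2, ¬ (p.1 ∈ insert z S ∧ p.2 ∈ insert z S) := by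
      intro p hp hc
      have := h3 hp
      simp only [EG, Finset.mem_filter, Finset.mem_sdiff] at this
      rcases Finset.mem_insert.1 hc.1 with h | h
      · exact hz (h ▸ this.2.2.2.1.1)
      · exact this.2.2.2.1.2 h
    rw [Prod.mk.injEq]
    constructor
    · ext p
      rw [Finset.mem_filter, Finset.mem_union]
      exact ⟨fun h => h.1.resolve_right fun h' => a2 p h' h.2, fun h => ⟨Or.inl h, a1 p h⟩⟩
    · ext p
      rw [Finset.mem_filter, Finset.mem_union]
      exact ⟨fun h => h.1.resolve_left fun h' => h.2 (a1 p h'), fun h => ⟨Or.inr h, a2 p h⟩⟩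
  · intro E hE
    simp only
    rw [← pow_add, Finset.card_filter_add_card_filter_not]

lemma Phi_key (R : P → P → Prop) (hR : Symmetric R) (γ : Fin n → P) (z : Fin n)
    (V : Finset (Fin n)) (hz : z ∉ V) :
    ∑ S ∈ V.powerset, Phi R γ z (insert z S) * (if Indep R γ (V \ S) then 1 else 0)
      = if Indep R γ (insert z V) then 1 else 0 := by
  rw [← sum_EG R hR γ (insert z V)]
  rw [← Finset.sum_fiberwise_of_maps_to (s := (EG R γ (insert z V)).powerset) (t := V.powerset)
    (g := fun E => V.filter (fun v => Rch E z v))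
    (fun E _ => Finset.mem_powerset.2 (Finset.filter_subset _ _))]
  apply Finset.sum_congr rfl
  intro S hS
  rw [fiber R γ z V S hz (Finset.mem_powerset.1 hS), sum_EG R hR]

lemma Phi_eq_fR (R : P → P → Prop) (hR : Symmetric R) (γ : Fin n → P) (z : Fin n) (m : ℕ) :
    ∀ V : Finset (Fin n), z ∉ V → V.card ≤ m →
    Phi R γ z (insert z V) = fR R γ m (fun p => R p (γ z)) V := by
  intro V
  induction V using Finset.strongInduction with
  | H V ih =>
    intro hz hm
    have h1 := Phi_key R hR γ z V hz
    have h2 : ∑ S ∈ V.powerset, fR R γ m (fun p => R p (γ z)) S *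
        (if Indep R γ (V \ S) then 1 else 0)
        = if Indep R γ V ∧ ∀ i ∈ V, ¬ R (γ i) (γ z) then 1 else 0 := by
      convert fR_key R hR γ m (fun p => R p (γ z)) V hm
    have h3 : Indep R γ (insert z V) ↔ (Indep R γ V ∧ ∀ i ∈ V, ¬ R (γ i) (γ z)) := by
      constructor
      · intro h
        refine ⟨fun i hi j hj => h i (Finset.mem_insert_of_mem hi) j (Finset.mem_insert_of_mem hj),
          fun i hi => h i (Finset.mem_insert_of_mem hi) z (Finset.mem_insert_self _ _) ?_⟩
        rintro rfl; exact hz hi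
      · rintro ⟨ha, hb⟩ i hi j hj hij
        rcases Finset.mem_insert.1 hi with hi' | hi' <;>
          rcases Finset.mem_insert.1 hj with hj' | hj'
        · exact absurd (hi'.trans hj'.symm) hij
        · rw [hi']; exact fun h => hb j hj' (hR h)
        · rw [hj']; exact hb i hi'
        · exact ha i hi' j hj' hij
    have h4 := h1.trans ((ite_iff_congr h3).trans h2.symm)
    have k1 := Finset.add_sum_erase V.powerset (fun S => Phi R γ z (insert z S) *
      (if Indep R γ (V \ S) then 1 else 0)) (Finset.mem_powerset_self V)
    have k2 := Finset.add_sum_erase V.powerset (fun S => fR R γ m (fun p => R p (γ z)) S *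
      (if Indep R γ (V \ S) then 1 else 0)) (Finset.mem_powerset_self V)
    have h5 : ∑ S ∈ V.powerset.erase V,
        Phi R γ z (insert z S) * (if Indep R γ (V \ S) then 1 else 0) =
        ∑ S ∈ V.powerset.erase V, fR R γ m (fun p => R p (γ z)) S *
          (if Indep R γ (V \ S) then 1 else 0) := by
      apply Finset.sum_congr rfl
      intro S hS
      rw [Finset.mem_erase, Finset.mem_powerset] at hS
      rw [ih S (hS.2.ssubset_of_ne hS.1) (fun h => hz (hS.2 h))
        ((Finset.card_le_card hS.2).trans hm)]
    have h6 : Indep R γ (V \ V) := by simp [Indep]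
    simp only [if_pos h6, mul_one] at k1 k2
    linarith

lemma rch_iff (g : SimpleGraph (Fin n)) (x y : Fin n) :
    Rch (edgePairs g) x y ↔ g.Reachable x y := by
  rw [SimpleGraph.reachable_iff_reflTransGen, Rch]
  have : Stp (edgePairs g) = g.Adj := by
    funext a b
    apply propext
    simp only [Stp, edgePairs, Finset.mem_filter, Finset.mem_univ, true_and]
    constructor
    · rintro (h | h)
      · exact h.2
      · exact h.2.symm
    · intro h
      rcases lt_or_gt_of_ne h.ne with h1 | h1
      · exact Or.inl ⟨h1, h⟩
      · exact Or.inr ⟨h1, h.symm⟩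
  rw [this]

lemma edgePairs_fromRel (E : Finset (Fin n × Fin n)) (hE : ∀ p ∈ E, p.1 < p.2) :
    edgePairs (SimpleGraph.fromRel (fun x y => (x, y) ∈ E)) = E := by
  ext ⟨x, y⟩
  simp only [SimpleGraph.fromRel_adj, edgePairs, Finset.mem_filter, Finset.mem_univ, true_and]
  constructor
  · rintro ⟨h1, _, h | h⟩
    · exact h
    · exact absurd (hE _ h) (not_lt.2 h1.le)
  · intro h
    exact ⟨hE _ h, (hE _ h).ne, Or.inl h⟩

lemma ursell_eq_Phi (R : P → P → Prop) {n : ℕ} (γ : Fin (n + 1) → P) :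
    polymerUrsell R γ = Phi R γ 0 Finset.univ := by
  unfold polymerUrsell Phi
  refine Finset.sum_nbij' (fun g => edgePairs g)
    (fun E => SimpleGraph.fromRel (fun x y => (x, y) ∈ E)) ?_ ?_ ?_ ?_ ?_
  · intro g hg
    simp only [Finset.mem_filter, Finset.mem_univ, true_and, Finset.mem_powerset] at hg ⊢
    refine ⟨?_, fun v _ => (rch_iff g 0 v).2 (hg.1.preconnected 0 v)⟩
    intro p hp
    have h1 := hg.2 p hp
    simp only [edgePairs, EG, Finset.mem_filter, Finset.mem_univ, true_and, and_true] at hp ⊢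
    exact ⟨hp.1, h1⟩
  · intro E hE
    simp only [Finset.mem_filter, Finset.mem_univ, true_and, Finset.mem_powerset] at hE ⊢
    have hlt : ∀ p ∈ E, p.1 < p.2 := fun p hp => by
      have := hE.1 hp
      simp only [EG, Finset.mem_filter] at this
      exact this.2.1
    have h1 := edgePairs_fromRel E hlt
    constructor
    · rw [SimpleGraph.connected_iff_exists_forall_reachable]
      refine ⟨0, fun v => ?_⟩
      rw [← rch_iff, h1]
      exact hE.2 v trivial
    · rw [h1]
      intro p hp
      have := hE.1 hp
      simp only [EG, Finset.mem_filter] at this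
      exact this.2.2.1
  · intro g hg
    ext x y
    simp only [SimpleGraph.fromRel_adj, edgePairs, Finset.mem_filter, Finset.mem_univ, true_and]
    constructor
    · rintro ⟨_, h | h⟩
      · exact h.2
      · exact h.2.symm
    · intro h
      refine ⟨h.ne, ?_⟩
      rcases lt_or_gt_of_ne h.ne with h1 | h1
      · exact Or.inl ⟨h1, h⟩
      · exact Or.inr ⟨h1, h.symm⟩
  · intro E hE
    simp only [Finset.mem_filter, Finset.mem_powerset] at hE
    refine edgePairs_fromRel E fun p hp => ?_
    have := hE.1 hp
    simp only [EG, Finset.mem_filter] at this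
    exact this.2.1
  · intro g hg
    rfl

lemma ursell_eq_fR (R : P → P → Prop) (hR : Symmetric R) {n : ℕ} (γ : Fin (n + 1) → P) (m : ℕ)
    (hm : n ≤ m) :
    polymerUrsell R γ = fR R γ m (fun p => R p (γ 0)) (Finset.univ.erase 0) := by
  rw [ursell_eq_Phi, ← Phi_eq_fR R hR γ 0 m _ (Finset.notMem_erase _ _) (by simpa using hm),
    Finset.insert_erase (Finset.mem_univ _)]

end FP

namespace FP

variable {P : Type*}

/-- weight of a compatible tuple in `N` -/
def wt {κ : Type*} [Fintype κ] (R : P → P → Prop) (ρ : P → ℝ≥0∞) (N : P → Prop) (δ : κ → P) :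
    ℝ≥0∞ :=
  if (∀ i, N (δ i)) ∧ (∀ i j, i ≠ j → ¬ R (δ i) (δ j)) then ∏ i, ρ (δ i) else 0

def nb {κ : Type*} (R : P → P → Prop) (δ : κ → P) : P → Prop := fun p => ∃ i, R p (δ i)

def tt (R : P → P → Prop) (ρ : P → ℝ≥0∞) (N : P → Prop) (k : ℕ) (g : (P → Prop) → ℝ≥0∞) : ℝ≥0∞ :=
  ((k.factorial : ℝ≥0∞))⁻¹ * ∑' δ : Fin k → P, wt R ρ N δ * g (nb R δ)

def aa (R : P → P → Prop) (ρ : P → ℝ≥0∞) : ℕ → ℕ → (P → Prop) → ℝ≥0∞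
  | 0, m, _ => if m = 0 then 1 else 0
  | n + 1, m, N => if m = 0 then 1 else
      ∑ k ∈ Finset.range m, tt R ρ N (k + 1) (aa R ρ n (m - (k + 1)))

lemma aa_zero (R : P → P → Prop) (ρ : P → ℝ≥0∞) (n : ℕ) (N : P → Prop) : aa R ρ n 0 N = 1 := by
  cases n <;> simp [aa]

lemma wt_reindex {κ κ' : Type*} [Fintype κ] [Fintype κ'] (e : κ ≃ κ') (R : P → P → Prop)
    (ρ : P → ℝ≥0∞) (N : P → Prop) (δ : κ' → P) :
    wt R ρ N (δ ∘ e) = wt R ρ N δ := by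
  unfold wt
  have h1 : (∀ i, N ((δ ∘ e) i)) ↔ ∀ i, N (δ i) := e.forall_congr_left.trans (by simp)
  have h2 : (∀ i j, i ≠ j → ¬ R ((δ ∘ e) i) ((δ ∘ e) j)) ↔ (∀ i j, i ≠ j → ¬ R (δ i) (δ j)) := by
    constructor
    · intro h i j hij
      simpa using h (e.symm i) (e.symm j) (by simpa using hij)
    · intro h i j hij
      exact h (e i) (e j) (by simpa using hij)
  have h3 : ∏ i, ρ ((δ ∘ e) i) = ∏ i, ρ (δ i) := Fintype.prod_equiv e _ _ (fun _ => rfl)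
  simp only [h1, h2, h3]

lemma nb_reindex {κ κ' : Type*} (e : κ ≃ κ') (R : P → P → Prop) (δ : κ' → P) :
    nb R (δ ∘ e) = nb R δ := by
  funext p
  apply propext
  exact ⟨fun ⟨i, hi⟩ => ⟨e i, hi⟩, fun ⟨i, hi⟩ => ⟨e.symm i, by simpa using hi⟩⟩

lemma tsum_reindex {κ : Type*} [Fintype κ] {k : ℕ} (hk : Fintype.card κ = k) (R : P → P → Prop)
    (ρ : P → ℝ≥0∞) (N : P → Prop) (g : (P → Prop) → ℝ≥0∞) :
    ∑' δ : κ → P, wt R ρ N δ * g (nb R δ) = ∑' δ : Fin k → P, wt R ρ N δ * g (nb R δ) := by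
  let e : κ ≃ Fin k := Fintype.equivFinOfCardEq hk
  rw [← (Equiv.arrowCongr e.symm (Equiv.refl P)).tsum_eq]
  apply tsum_congr
  intro δ
  have : (Equiv.arrowCongr e.symm (Equiv.refl P)) δ = δ ∘ e := by
    funext i; simp [Equiv.arrowCongr]
  rw [this, wt_reindex, nb_reindex]

lemma fact_mul_inv (k : ℕ) (x : ℝ≥0∞) : (k.factorial : ℝ≥0∞) * ((k.factorial : ℝ≥0∞)⁻¹ * x) = x := by
  rw [← mul_assoc, ENNReal.mul_inv_cancel (by exact_mod_cast k.factorial_ne_zero)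
    (ENNReal.natCast_ne_top _), one_mul]

lemma tsum_eq_tt {κ : Type*} [Fintype κ] {k : ℕ} (hk : Fintype.card κ = k) (R : P → P → Prop)
    (ρ : P → ℝ≥0∞) (N : P → Prop) (g : (P → Prop) → ℝ≥0∞) :
    ∑' δ : κ → P, wt R ρ N δ * g (nb R δ) = k.factorial * tt R ρ N k g := by
  rw [tsum_reindex hk, tt, fact_mul_inv]

/-- extension by a default polymer -/
def ex {ι : Type*} (p0 : P) (V : Finset ι) (γ : V → P) : ι → P :=
  fun i => if h : i ∈ V then γ ⟨i, h⟩ else p0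

def splitEquiv {ι : Type*} (V L : Finset ι) (hL : L ⊆ V) :
    (V → P) ≃ (L → P) × ((V \ L : Finset ι) → P) where
  toFun γ := (fun i => γ ⟨i, hL i.2⟩, fun i => γ ⟨i, (Finset.mem_sdiff.1 i.2).1⟩)
  invFun x := fun i => if h : (i : ι) ∈ L then x.1 ⟨i, h⟩ else x.2 ⟨i, Finset.mem_sdiff.2 ⟨i.2, h⟩⟩
  left_inv γ := by
    funext i
    by_cases h : (i : ι) ∈ L <;> simp [h]
  right_inv x := by
    refine Prod.ext ?_ ?_
    · funext i
      simp
    · funext i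
      have := (Finset.mem_sdiff.1 i.2).2
      simp [this]

lemma prod_split {ι : Type*} (V L : Finset ι) (hL : L ⊆ V) (ρ : P → ℝ≥0∞) (γ : V → P) :
    ∏ i, ρ (γ i) = (∏ i, ρ ((splitEquiv V L hL γ).1 i)) * ∏ i, ρ ((splitEquiv V L hL γ).2 i) := by
  let f : ι → ℝ≥0∞ := fun i => if h : i ∈ V then ρ (γ ⟨i, h⟩) else 1
  have h1 : ∏ i, ρ (γ i) = ∏ i ∈ V, f i := by
    rw [← Finset.prod_coe_sort V f]
    apply Finset.prod_congr rfl
    intro i _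
    simp [f]
  have h2 : ∏ i, ρ ((splitEquiv V L hL γ).1 i) = ∏ i ∈ L, f i := by
    rw [← Finset.prod_coe_sort L f]
    apply Finset.prod_congr rfl
    intro i _
    simp [f, splitEquiv, hL i.2]
  have h3 : ∏ i, ρ ((splitEquiv V L hL γ).2 i) = ∏ i ∈ V \ L, f i := by
    rw [← Finset.prod_coe_sort (V \ L) f]
    apply Finset.prod_congr rfl
    intro i _
    simp [f, splitEquiv, (Finset.mem_sdiff.1 i.2).1]
  rw [h1, h2, h3, mul_comm, Finset.prod_sdiff hL]

lemma term_eq {ι : Type*} (R : P → P → Prop) (ρ : P → ℝ≥0∞) (p0 : P) (n : ℕ)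
    (V : Finset ι) (N : P → Prop) (L : Finset ι) (hL : L ⊆ V) (γ : V → P) :
    (if ((∀ i ∈ L, N (ex p0 V γ i)) ∧ Indep R (ex p0 V γ) L) then
      ((fR R (ex p0 V γ) n (fun p => ∃ j ∈ L, R p (ex p0 V γ j)) (V \ L)).natAbs : ℝ≥0∞) else 0)
        * ∏ i, ρ (γ i)
    = wt R ρ N (splitEquiv V L hL γ).1 *
      (((fR R (ex p0 (V \ L) (splitEquiv V L hL γ).2) n (nb R (splitEquiv V L hL γ).1)
        (V \ L)).natAbs : ℝ≥0∞) * ∏ i, ρ ((splitEquiv V L hL γ).2 i)) := by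
  have hex : ∀ i : L, ex p0 V γ i = (splitEquiv V L hL γ).1 i := by
    intro i; simp [ex, splitEquiv, hL i.2]
  have hnb : (fun p => ∃ j ∈ L, R p (ex p0 V γ j)) = nb R (splitEquiv V L hL γ).1 := by
    funext p
    apply propext
    constructor
    · rintro ⟨j, hj, h⟩; exact ⟨⟨j, hj⟩, by rw [← hex]; exact h⟩
    · rintro ⟨j, h⟩; exact ⟨j, j.2, by rw [hex]; exact h⟩
  have hf : fR R (ex p0 V γ) n (nb R (splitEquiv V L hL γ).1) (V \ L) =
      fR R (ex p0 (V \ L) (splitEquiv V L hL γ).2) n (nb R (splitEquiv V L hL γ).1) (V \ L) := by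
    apply fR_congr
    intro i hi
    have hi' := Finset.mem_sdiff.1 hi
    simp only [ex, dif_pos hi, dif_pos hi'.1, splitEquiv, Equiv.coe_fn_mk]
  have hc : ((∀ i ∈ L, N (ex p0 V γ i)) ∧ Indep R (ex p0 V γ) L) ↔
      ((∀ i, N ((splitEquiv V L hL γ).1 i)) ∧
        (∀ i j, i ≠ j → ¬ R ((splitEquiv V L hL γ).1 i) ((splitEquiv V L hL γ).1 j))) := by
    constructor
    · rintro ⟨h1, h2⟩
      refine ⟨fun i => hex i ▸ h1 i i.2, fun i j hij => ?_⟩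
      rw [← hex, ← hex]
      exact h2 i i.2 j j.2 (fun h => hij (Subtype.ext h))
    · rintro ⟨h1, h2⟩
      refine ⟨fun i hi => ?_, fun i hi j hj hij => ?_⟩
      · rw [hex ⟨i, hi⟩]; exact h1 _
      · rw [hex ⟨i, hi⟩, hex ⟨j, hj⟩]
        exact h2 _ _ (fun h => hij (congrArg Subtype.val h))
  rw [hnb, hf, prod_split V L hL]
  unfold wt
  by_cases h : ((∀ i ∈ L, N (ex p0 V γ i)) ∧ Indep R (ex p0 V γ) L)
  · rw [if_pos h, if_pos (hc.1 h)]; ring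
  · rw [if_neg h, if_neg (fun h' => h (hc.2 h'))]; ring

lemma B_bound {ι : Type*} (R : P → P → Prop) (ρ : P → ℝ≥0∞) (p0 : P) (n : ℕ) :
    ∀ (V : Finset ι) (N : P → Prop),
      ∑' γ : V → P, ((fR R (ex p0 V γ) n N V).natAbs : ℝ≥0∞) * ∏ i, ρ (γ i)
        ≤ V.card.factorial * aa R ρ n V.card N := by
  induction n with
  | zero =>
    intro V N
    by_cases hV : V = ∅
    · subst hV
      rw [tsum_eq_single default (fun b hb => absurd (Subsingleton.elim _ _) hb)]
      simp [fR, aa]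
    · simp [fR, hV]
  | succ n ih =>
    intro V N
    by_cases hV : V = ∅
    · subst hV
      rw [tsum_eq_single default (fun b hb => absurd (Subsingleton.elim _ _) hb)]
      simp [fR, aa]
    have hcard : V.card ≠ 0 := by simpa using hV
    set m := V.card with hm
    calc ∑' γ : V → P, ((fR R (ex p0 V γ) (n+1) N V).natAbs : ℝ≥0∞) * ∏ i, ρ (γ i)
        ≤ ∑' γ : V → P, ∑ L ∈ V.powerset.filter (fun L => L.Nonempty),
          (if ((∀ i ∈ L, N (ex p0 V γ i)) ∧ Indep R (ex p0 V γ) L) then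
      ((fR R (ex p0 V γ) n (fun p => ∃ j ∈ L, R p (ex p0 V γ j)) (V \ L)).natAbs : ℝ≥0∞) else 0)
        * ∏ i, ρ (γ i) := by
          apply ENNReal.tsum_le_tsum
          intro γ
          rw [← Finset.sum_mul]
          gcongr
          simp only [fR, if_neg hV]
          rw [← Finset.sum_filter, Finset.filter_filter]
          refine le_trans (Nat.cast_le.2 (Int.natAbs_sum_le _ _)) ?_
          rw [Nat.cast_sum]
          apply le_of_eq
          apply Finset.sum_congr rfl
          intro L _
          simp [Int.natAbs_mul, Int.natAbs_pow]
      _ = ∑ L ∈ V.powerset.filter (fun L => L.Nonempty), ∑' γ : V → P,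
          (if ((∀ i ∈ L, N (ex p0 V γ i)) ∧ Indep R (ex p0 V γ) L) then
      ((fR R (ex p0 V γ) n (fun p => ∃ j ∈ L, R p (ex p0 V γ j)) (V \ L)).natAbs : ℝ≥0∞) else 0)
        * ∏ i, ρ (γ i) := Summable.tsum_finsetSum (fun _ _ => ENNReal.summable)
      _ ≤ ∑ L ∈ V.powerset.filter (fun L => L.Nonempty),
          ((m - L.card).factorial * (L.card.factorial * tt R ρ N L.card (aa R ρ n (m - L.card)))) := by
          apply Finset.sum_le_sum
          intro L hL
          rw [Finset.mem_filter, Finset.mem_powerset] at hL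
          rw [tsum_congr (fun γ => term_eq R ρ p0 n V N L hL.1 γ)]
          rw [(splitEquiv V L hL.1).tsum_eq (fun x : (L → P) × ((V \ L : Finset ι) → P) =>
            wt R ρ N x.1 * (((fR R (ex p0 (V \ L) x.2) n (nb R x.1)
        (V \ L)).natAbs : ℝ≥0∞) * ∏ i, ρ (x.2 i)))]
          rw [ENNReal.tsum_prod']
          rw [← tsum_eq_tt (κ := L) (by simp), ← ENNReal.tsum_mul_left]
          apply ENNReal.tsum_le_tsum
          intro δ
          simp only
          rw [ENNReal.tsum_mul_left, mul_left_comm]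
          gcongr
          refine (ih (V \ L) (nb R δ)).trans ?_
          rw [Finset.card_sdiff_of_subset hL.1]
      _ = ∑ L ∈ V.powerset, (fun l => if l = 0 then 0 else
          ((m - l).factorial * (l.factorial * tt R ρ N l (aa R ρ n (m - l))))) L.card := by
          rw [Finset.sum_filter]
          apply Finset.sum_congr rfl
          intro L _
          by_cases h : L = ∅
          · simp [h]
          · have : L.card ≠ 0 := by simpa using h
            simp only [if_neg this, if_pos (Finset.nonempty_iff_ne_empty.2 h)]
      _ = (m.factorial : ℝ≥0∞) * aa R ρ (n+1) m N := by
          rw [Finset.sum_powerset_apply_card (fun l => if l = 0 then 0 else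
            ((m - l).factorial * (l.factorial * tt R ρ N l (aa R ρ n (m - l))))), Finset.sum_range_succ', ← hm]
          simp only [if_true, smul_zero, add_zero, Nat.succ_ne_zero, if_false]
          rw [aa, if_neg hcard, Finset.mul_sum]
          apply Finset.sum_congr rfl
          intro k hk
          rw [Finset.mem_range] at hk
          rw [nsmul_eq_mul, ← mul_assoc, ← mul_assoc, ← Nat.choose_mul_factorial_mul_factorial
            (show k + 1 ≤ m by omega)]
          push_cast
          ring

end FP

namespace FP

variable {P : Type*}

lemma tsum_succ' (f : ℕ → ℝ≥0∞) : ∑' n, f n = f 0 + ∑' n, f (n + 1) :=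
  tsum_eq_zero_add' ENNReal.summable

lemma cauchy (f : ℕ → ℕ → ℝ≥0∞) :
    ∑' m : ℕ, ∑ k ∈ Finset.range (m + 1), f k (m - k) = ∑' k : ℕ, ∑' r : ℕ, f k r := by
  rw [← ENNReal.tsum_prod,
    ← (Finset.HasAntidiagonal.sigmaAntidiagonalEquivProd (A := ℕ)).tsum_eq, ENNReal.tsum_sigma']
  apply tsum_congr
  intro m
  rw [← Finset.Nat.sum_antidiagonal_eq_sum_range_succ f m, tsum_fintype,
    ← Finset.sum_coe_sort (Finset.HasAntidiagonal.antidiagonal m)]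
  rfl

/-- the partition function restricted to `N` -/
def yy (R : P → P → Prop) (μ : P → ℝ≥0∞) (N : P → Prop) (k : ℕ) : ℝ≥0∞ :=
  ((k.factorial : ℝ≥0∞))⁻¹ * ∑' δ : Fin k → P, wt R μ N δ

def YY (R : P → P → Prop) (μ : P → ℝ≥0∞) (N : P → Prop) : ℝ≥0∞ := ∑' k : ℕ, yy R μ N k

lemma yy_zero (R : P → P → Prop) (μ : P → ℝ≥0∞) (N : P → Prop) : yy R μ N 0 = 1 := by
  unfold yy
  rw [tsum_eq_single default (fun b hb => absurd (Subsingleton.elim _ _) hb)]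
  simp [wt]

lemma tsum_wt {κ : Type*} [Fintype κ] {k : ℕ} (hk : Fintype.card κ = k) (R : P → P → Prop)
    (ρ : P → ℝ≥0∞) (N : P → Prop) :
    ∑' δ : κ → P, wt R ρ N δ = k.factorial * yy R ρ N k := by
  have := tsum_reindex hk R ρ N (fun _ => 1)
  simp only [mul_one] at this
  rw [this, yy, fact_mul_inv]

lemma XiHat_eq (R : P → P → Prop) (μ : P → ℝ) (γ : P) :
    XiHat R μ γ = YY R (fun p => ENNReal.ofReal (μ p)) (fun p => R p γ) := by
  unfold YY
  rw [tsum_succ', yy_zero]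
  unfold XiHat yy wt
  refine congrArg (1 + ·) (tsum_congr fun m => congrArg _ (tsum_congr fun δ => ?_))
  congr

lemma wt_or_le {m : ℕ} (R : P → P → Prop) (μ : P → ℝ≥0∞) (N₁ N₂ : P → Prop) (δ : Fin m → P) :
    wt R μ (fun p => N₁ p ∨ N₂ p) δ ≤ ∑ L ∈ (Finset.univ : Finset (Fin m)).powerset,
            wt R μ N₁ (fun i : {i // i ∈ L} => δ i) * wt R μ N₂ (fun i : {i // i ∉ L} => δ i) := by
  by_cases h : (∀ i, N₁ (δ i) ∨ N₂ (δ i)) ∧ (∀ i j, i ≠ j → ¬ R (δ i) (δ j))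
  · refine le_trans ?_ (Finset.single_le_sum (fun _ _ => zero_le)
      (Finset.mem_powerset.2 (Finset.subset_univ (Finset.univ.filter (fun i => N₁ (δ i))))))
    set L := Finset.univ.filter (fun i => N₁ (δ i)) with hL
    have hmem : ∀ i, i ∈ L ↔ N₁ (δ i) := by intro i; simp [hL]
    unfold wt
    rw [if_pos h, if_pos ⟨fun i => (hmem i).1 i.2, fun i j hij => h.2 i j
        (fun h => hij (Subtype.ext h))⟩,
      if_pos ⟨fun i => (h.1 i).resolve_left (fun h' => i.2 ((hmem i).2 h')), fun i j hij => h.2 i j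
        (fun h => hij (Subtype.ext h))⟩]
    apply le_of_eq
    convert (Fintype.prod_subtype_mul_prod_subtype (fun i => i ∈ L) (fun i => μ (δ i))).symm
  · unfold wt
    rw [if_neg h]
    exact zero_le

lemma yy_or_le (R : P → P → Prop) (μ : P → ℝ≥0∞) (N₁ N₂ : P → Prop) (m : ℕ) :
    yy R μ (fun p => N₁ p ∨ N₂ p) m ≤ ∑ k ∈ Finset.range (m + 1), yy R μ N₁ k * yy R μ N₂ (m - k) := by
  have key : ∑' δ : Fin m → P, wt R μ (fun p => N₁ p ∨ N₂ p) δ ≤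
      m.factorial * ∑ k ∈ Finset.range (m + 1), yy R μ N₁ k * yy R μ N₂ (m - k) := by
    calc ∑' δ : Fin m → P, wt R μ (fun p => N₁ p ∨ N₂ p) δ
        ≤ ∑' δ : Fin m → P, ∑ L ∈ (Finset.univ : Finset (Fin m)).powerset,
            wt R μ N₁ (fun i : {i // i ∈ L} => δ i) * wt R μ N₂ (fun i : {i // i ∉ L} => δ i) :=
          ENNReal.tsum_le_tsum (fun δ => wt_or_le R μ N₁ N₂ δ)
      _ = ∑ L ∈ (Finset.univ : Finset (Fin m)).powerset, ∑' δ : Fin m → P,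
            wt R μ N₁ (fun i : {i // i ∈ L} => δ i) * wt R μ N₂ (fun i : {i // i ∉ L} => δ i) :=
          Summable.tsum_finsetSum (fun _ _ => ENNReal.summable)
      _ = ∑ L ∈ (Finset.univ : Finset (Fin m)).powerset, (fun l => (l.factorial * yy R μ N₁ l) *
            ((m - l).factorial * yy R μ N₂ (m - l))) L.card := by
          apply Finset.sum_congr rfl
          intro L _
          refine Eq.trans
            ((Equiv.piEquivPiSubtypeProd (fun i => i ∈ L) (fun _ : Fin m => P)).tsum_eq
            (fun x : ({i // i ∈ L} → P) × ({i // i ∉ L} → P) => wt R μ N₁ x.1 * wt R μ N₂ x.2)) ?_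
          rw [ENNReal.tsum_prod']
          simp only [ENNReal.tsum_mul_left, ENNReal.tsum_mul_right]
          rw [tsum_wt (k := L.card) (by simp), tsum_wt (k := m - L.card)
            (by rw [Fintype.card_subtype_compl]; simp)]
      _ = _ := by
          rw [Finset.sum_powerset_apply_card (fun l => ((l.factorial : ℝ≥0∞) * yy R μ N₁ l) *
            ((m - l).factorial * yy R μ N₂ (m - l))), Finset.mul_sum]
          rw [Finset.card_univ, Fintype.card_fin]
          apply Finset.sum_congr rfl
          intro k hk
          rw [Finset.mem_range] at hk
          rw [nsmul_eq_mul, ← Nat.choose_mul_factorial_mul_factorial (show k ≤ m by omega)]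
          push_cast
          ring
  rw [yy]
  refine (mul_le_mul_right key _).trans ?_
  rw [← mul_assoc, ENNReal.inv_mul_cancel (by exact_mod_cast m.factorial_ne_zero)
    (ENNReal.natCast_ne_top _), one_mul]

lemma YY_or_le (R : P → P → Prop) (μ : P → ℝ≥0∞) (N₁ N₂ : P → Prop) :
    YY R μ (fun p => N₁ p ∨ N₂ p) ≤ YY R μ N₁ * YY R μ N₂ := by
  unfold YY
  refine (ENNReal.tsum_le_tsum (yy_or_le R μ N₁ N₂)).trans ?_
  rw [cauchy (fun k r => yy R μ N₁ k * yy R μ N₂ r)]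
  simp only [ENNReal.tsum_mul_left, ENNReal.tsum_mul_right]
  exact le_rfl

lemma YY_nb_le (R : P → P → Prop) (μ : P → ℝ≥0∞) : ∀ (k : ℕ) (δ : Fin k → P),
    YY R μ (nb R δ) ≤ ∏ i, YY R μ (fun p => R p (δ i)) := by
  intro k
  induction k with
  | zero =>
    intro δ
    unfold YY
    rw [tsum_eq_single 0, yy_zero]
    · simp
    · intro b hb
      unfold yy
      have : ∀ ε : Fin b → P, wt R μ (nb R δ) ε = 0 := by
        intro ε
        unfold wt
        rw [if_neg]
        rintro ⟨h, _⟩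
        obtain ⟨i, _⟩ := h ⟨0, Nat.pos_of_ne_zero hb⟩
        exact i.elim0
      simp [this]
  | succ k ih =>
    intro δ
    have : nb R δ = fun p => R p (δ 0) ∨ nb R (fun i : Fin k => δ i.succ) p := by
      funext p
      apply propext
      exact Fin.exists_fin_succ
    rw [this, Fin.prod_univ_succ]
    refine (YY_or_le _ _ _ _).trans ?_
    gcongr
    exact ih _

lemma aa_bound (R : P → P → Prop) (ρ μ : P → ℝ≥0∞)
    (h : ∀ p, ρ p * YY R μ (fun q => R q p) ≤ μ p) (n : ℕ) :
    ∀ N, ∑' m, aa R ρ n m N ≤ YY R μ N := by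
  induction n with
  | zero =>
    intro N
    simp only [aa, tsum_ite_eq]
    unfold YY
    rw [← yy_zero R μ N]
    exact ENNReal.le_tsum 0
  | succ n ih =>
    intro N
    rw [tsum_succ' (fun m => aa R ρ (n+1) m N), aa_zero, YY, tsum_succ' (yy R μ N), yy_zero]
    gcongr 1 + ?_
    have e1 : ∀ m, aa R ρ (n+1) (m+1) N =
        ∑ k ∈ Finset.range (m + 1), tt R ρ N (k + 1) (aa R ρ n (m - k)) := by
      intro m
      simp [aa]
    rw [tsum_congr e1, cauchy (fun k r => tt R ρ N (k + 1) (aa R ρ n r))]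
    apply ENNReal.tsum_le_tsum
    intro k
    unfold tt yy
    rw [ENNReal.tsum_mul_left]
    gcongr
    rw [ENNReal.tsum_comm]
    apply ENNReal.tsum_le_tsum
    intro δ
    rw [ENNReal.tsum_mul_left]
    refine (mul_le_mul_right ((ih (nb R δ)).trans (YY_nb_le R μ _ δ)) _).trans ?_
    unfold wt
    split_ifs
    · rw [← Finset.prod_mul_distrib]
      exact Finset.prod_le_prod' (fun i _ => h _)
    · simp

lemma ursell_sum (R : P → P → Prop) (hR : Symmetric R) (ρ : P → ℝ≥0∞) (γ0 : P) (m M : ℕ)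
    (hm : m ≤ M) :
    ∑' γs : Fin m → P, ((polymerUrsell R (Fin.cons γ0 γs : Fin (m + 1) → P)).natAbs : ℝ≥0∞) *
          ∏ i, ρ (γs i) ≤ m.factorial * aa R ρ M m (fun p => R p γ0) := by
  let V : Finset (Fin (m + 1)) := Finset.univ.erase 0
  have hV : V.card = m := by simp [V]
  have hB := B_bound R ρ γ0 M V (fun p => R p γ0)
  rw [hV] at hB
  refine le_trans (le_of_eq ?_) hB
  let e : Fin m ≃ V :=
    { toFun := fun i => ⟨i.succ, by simp [V, Fin.succ_ne_zero]⟩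
      invFun := fun i => (i : Fin (m + 1)).pred (Finset.ne_of_mem_erase i.2)
      left_inv := fun i => by simp
      right_inv := fun i => by simp }
  rw [← (Equiv.arrowCongr e (Equiv.refl P)).tsum_eq]
  apply tsum_congr
  intro γs
  have h1 : ∀ i, Equiv.arrowCongr e (Equiv.refl P) γs i = γs (e.symm i) := fun i => rfl
  have h2 : ex γ0 V (Equiv.arrowCongr e (Equiv.refl P) γs) = (Fin.cons γ0 γs : Fin (m + 1) → P) := by
    funext i
    refine Fin.cases ?_ (fun i => ?_) i
    · simp [ex, V]
    · have : i.succ ∈ V := by simp [V, Fin.succ_ne_zero]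
      simp only [ex, dif_pos this, h1, Fin.cons_succ]
      congr 1
  rw [h2, ursell_eq_fR R hR _ M hm]
  congr 1
  exact Fintype.prod_equiv e _ _ (fun i => by rw [h1, e.symm_apply_apply])

lemma PiAbs_le (R : P → P → Prop) (hR : Symmetric R) (ρ μ : P → ℝ)
    (hcrit : ∀ γ, ENNReal.ofReal (ρ γ) * XiHat R μ γ ≤ ENNReal.ofReal (μ γ)) (γ0 : P) :
    PiAbs R ρ γ0 ≤ XiHat R μ γ0 := by
  rw [XiHat_eq]
  apply ENNReal.tsum_le_of_sum_range_le
  intro M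
  refine le_trans ?_ (aa_bound R (fun p => ENNReal.ofReal (ρ p)) (fun p => ENNReal.ofReal (μ p))
    (fun p => by rw [← XiHat_eq]; exact hcrit p) M (fun p => R p γ0))
  refine le_trans ?_ (ENNReal.sum_le_tsum (Finset.range M))
  apply Finset.sum_le_sum
  intro m hm
  refine (mul_le_mul_right (ursell_sum R hR (fun p => ENNReal.ofReal (ρ p)) γ0 m M (Finset.mem_range.1 hm).le) _).trans ?_
  rw [← mul_assoc, ENNReal.inv_mul_cancel (by exact_mod_cast m.factorial_ne_zero)
    (ENNReal.natCast_ne_top _), one_mul]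

end FP

/-- Fernández–Procacci convergence criterion for the abstract polymer gas: if
`ρ_γ Ξ_γ(μ) ≤ μ_γ` (with `Ξ_γ(μ) < ∞`) for all polymers `γ`, then the series
`|Π|_{γ_0}(ρ)` is finite and bounded by `Ξ_{γ_0}(μ)`; in particular
`ρ_{γ_0} |Π|_{γ_0}(ρ) ≤ μ_{γ_0}`. -/
theorem statement19 {P : Type*} [Countable P] (R : P → P → Prop)
    (hRsymm : Symmetric R) (hRrefl : Reflexive R)
    (ρ μ : P → ℝ) (hρ : ∀ γ, 0 ≤ ρ γ) (hμ : ∀ γ, 0 < μ γ)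
    (hXifin : ∀ γ, XiHat R μ γ < ⊤)
    (hcrit : ∀ γ, ENNReal.ofReal (ρ γ) * XiHat R μ γ ≤ ENNReal.ofReal (μ γ)) :
    ∀ γ0 : P, PiAbs R ρ γ0 < ⊤ ∧ PiAbs R ρ γ0 ≤ XiHat R μ γ0 ∧
      ENNReal.ofReal (ρ γ0) * PiAbs R ρ γ0 ≤ ENNReal.ofReal (μ γ0) := by
  intro γ0
  have h := FP.PiAbs_le R hRsymm ρ μ hcrit γ0
  exact ⟨h.trans_lt (hXifin γ0), h, (by gcongr : _ ≤ _).trans (hcrit γ0)⟩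

end
end
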